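/- Let X be a complex m×n matrix. Then ‖X‖_cbF² = ‖X*X‖_cbB, where X* is the conjugate transpose of X. -/

import Mathlib

open Matrix
open scoped ComplexOrder

noncomputable section

namespace MatFact

/-- ℓ² norm of a complex vector. -/
def vnorm {n : ℕ} (v : Fin n → ℂ) : ℝ := Real.sqrt (∑ j, ‖v j‖ ^ 2)

/-- Operator norm of a matrix as a map ℓ²(Fin n) → ℓ²(Fin m). -/
def opNorm {m n : ℕ} (X : Matrix (Fin m) (Fin n) ℂ) : ℝ :=
  sSup {c : ℝ | ∃ v : Fin n → ℂ, vnorm v ≤ 1 ∧ c = vnorm (X.mulVec v)}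

/-- Column norm: the maximal ℓ² norm of a column. -/
def colNorm {m n : ℕ} (X : Matrix (Fin m) (Fin n) ℂ) : ℝ :=
  ⨆ j : Fin n, vnorm (fun i => X i j)

/-- Hilbert–Schmidt (Frobenius) norm. -/
def frobNorm {m n : ℕ} (X : Matrix (Fin m) (Fin n) ℂ) : ℝ :=
  Real.sqrt (∑ i, ∑ j, ‖X i j‖ ^ 2)

/-- Schur norm: operator norm of Schur (entrywise) multiplication by `X`
on matrices with the operator norm. -/
def schurNorm {m n : ℕ} (X : Matrix (Fin m) (Fin n) ℂ) : ℝ :=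
  sSup {c : ℝ | ∃ A : Matrix (Fin m) (Fin n) ℂ, opNorm A ≤ 1 ∧
    c = opNorm (Matrix.hadamard X A)}

/-- The T-norm (bilinear Schur norm). -/
def Tnorm {m n : ℕ} (X : Matrix (Fin m) (Fin n) ℂ) : ℝ :=
  sSup {c : ℝ | ∃ (a : Fin m → ℂ) (B : Matrix (Fin m) (Fin n) ℂ),
    (∀ i, ‖a i‖ ≤ 1) ∧ opNorm B ≤ 1 ∧
    c = vnorm (fun j => ∑ i, a i * X i j * B i j)}

/-- The F-norm: operator norm of `X` from `ℂⁿ` with the sup norm to `ℂᵐ`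
with the ℓ² norm. -/
def Fnorm {m n : ℕ} (X : Matrix (Fin m) (Fin n) ℂ) : ℝ :=
  sSup {c : ℝ | ∃ v : Fin n → ℂ, (∀ j, ‖v j‖ ≤ 1) ∧ c = vnorm (X.mulVec v)}

/-- The bilinear form norm. -/
def Bnorm {m n : ℕ} (Y : Matrix (Fin m) (Fin n) ℂ) : ℝ :=
  sSup {c : ℝ | ∃ (a : Fin m → ℂ) (b : Fin n → ℂ), (∀ i, ‖a i‖ ≤ 1) ∧
    (∀ j, ‖b j‖ ≤ 1) ∧ c = ‖∑ i, ∑ j, Y i j * a i * b j‖}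

/-- The completely bounded F-norm. -/
def cbF {m n : ℕ} (X : Matrix (Fin m) (Fin n) ℂ) : ℝ :=
  sInf {c : ℝ | ∃ (A : Matrix (Fin m) (Fin n) ℂ) (ξ : Fin n → ℂ),
    X = A * Matrix.diagonal ξ ∧ c = opNorm A * vnorm ξ}

/-- The completely bounded bilinear form norm. -/
def cbB {m n : ℕ} (X : Matrix (Fin m) (Fin n) ℂ) : ℝ :=
  sInf {c : ℝ | ∃ (η : Fin m → ℂ) (B : Matrix (Fin m) (Fin n) ℂ) (ξ : Fin n → ℂ),
    X = Matrix.diagonal η * B * Matrix.diagonal ξ ∧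
    c = vnorm η * opNorm B * vnorm ξ}

/-- The range (column space) of a matrix, as a submodule of `ℂᵐ`. -/
def ran {m n : ℕ} (X : Matrix (Fin m) (Fin n) ℂ) : Submodule ℂ (Fin m → ℂ) :=
  LinearMap.range X.mulVecLin

/-- `P` is the orthogonal projection onto the subspace `E`, i.e. `P` is a
Hermitian idempotent with range `E`. -/
def IsOrthProjOnto {n : ℕ} (P : Matrix (Fin n) (Fin n) ℂ)
    (E : Submodule ℂ (Fin n → ℂ)) : Prop :=
  P.IsHermitian ∧ P * P = P ∧ ran P = E

/-- `W` is a partial isometry with support `E` and range `F`. -/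
def IsPartialIsometryFromTo {m n : ℕ} (W : Matrix (Fin m) (Fin n) ℂ)
    (E : Submodule ℂ (Fin n → ℂ)) (F : Submodule ℂ (Fin m → ℂ)) : Prop :=
  IsOrthProjOnto (Wᴴ * W) E ∧ IsOrthProjOnto (W * Wᴴ) F

/-- A cb operator factorization of `X`. -/
def IsCbOpFact {m n : ℕ} (X A : Matrix (Fin m) (Fin n) ℂ) (ξ : Fin n → ℂ) : Prop :=
  (∀ j, 0 ≤ ξ j) ∧ vnorm ξ = 1 ∧ opNorm A = cbF X ∧
  (∀ j, ξ j = 0 → ∀ i, A i j = 0) ∧ X = A * Matrix.diagonal ξ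

/-- A cb bilinear form factorization of `X`. -/
def IsCbBilFact {m n : ℕ} (X : Matrix (Fin m) (Fin n) ℂ) (η : Fin m → ℂ)
    (B : Matrix (Fin m) (Fin n) ℂ) (ξ : Fin n → ℂ) : Prop :=
  (∀ i, 0 ≤ η i) ∧ (∀ j, 0 ≤ ξ j) ∧ vnorm η = 1 ∧ vnorm ξ = 1 ∧
  opNorm B = cbB X ∧ (∀ j, ξ j = 0 → ∀ i, B i j = 0) ∧
  (∀ i, η i = 0 → ∀ j, B i j = 0) ∧ X = Matrix.diagonal η * B * Matrix.diagonal ξ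

/-- A Schur factorization of `X`. -/
def IsSchurFact {m n : ℕ} (X : Matrix (Fin m) (Fin n) ℂ)
    (F : Matrix (Fin m) (Fin m) ℂ) (W : Matrix (Fin m) (Fin n) ℂ)
    (G : Matrix (Fin n) (Fin n) ℂ) : Prop :=
  F.PosSemidef ∧ (∀ i, (F * F) i i ≤ 1) ∧ G.PosSemidef ∧ (∀ j, (G * G) j j ≤ 1) ∧
  IsPartialIsometryFromTo W (ran G) (ran F) ∧
  X = (schurNorm X : ℂ) • (F * W * G)

/-- A bilinear Schur factorization of `X`. -/
def IsBilinSchurFact {m n : ℕ} (X : Matrix (Fin m) (Fin n) ℂ)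
    (T : Matrix (Fin m) (Fin m) ℂ) (W : Matrix (Fin m) (Fin n) ℂ)
    (G : Matrix (Fin n) (Fin n) ℂ) : Prop :=
  T.PosSemidef ∧ frobNorm T = Tnorm X ∧ G.PosSemidef ∧ (∀ j, (G * G) j j ≤ 1) ∧
  IsPartialIsometryFromTo W (ran G) (ran T) ∧ X = T * W * G

/-- Maximal diagonal entry (real part) of a square matrix. -/
def maxDiag {n : ℕ} (P : Matrix (Fin n) (Fin n) ℂ) : ℝ := ⨆ i, (P i i).re

end MatFact

namespace MatFact

open scoped Matrix.Norms.L2Operator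

theorem vnorm_eq_norm_toLp {n : ℕ} (v : Fin n → ℂ) : vnorm v = ‖WithLp.toLp 2 v‖ := by
  rw [EuclideanSpace.norm_eq]
  rfl

theorem vnorm_nonneg {n : ℕ} (v : Fin n → ℂ) : 0 ≤ vnorm v :=
  Real.sqrt_nonneg _

theorem vnorm_sq {n : ℕ} (v : Fin n → ℂ) : vnorm v ^ 2 = ∑ j, ‖v j‖ ^ 2 :=
  Real.sq_sqrt (by positivity)

theorem vnorm_star {n : ℕ} (v : Fin n → ℂ) : vnorm (star v) = vnorm v := by
  simp [vnorm]

theorem vnorm_eq_zero {n : ℕ} {v : Fin n → ℂ} : vnorm v = 0 ↔ v = 0 := by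
  rw [vnorm_eq_norm_toLp, norm_eq_zero, WithLp.toLp_eq_zero]

theorem opNorm_eq_norm {m n : ℕ} (X : Matrix (Fin m) (Fin n) ℂ) : opNorm X = ‖X‖ := by
  rw [l2_opNorm_def, ← ContinuousLinearMap.sSup_unitClosedBall_eq_norm, opNorm]
  congr 1
  ext c
  simp only [Set.mem_ofPred_eq, Set.mem_image, Metric.mem_closedBall, dist_zero_right]
  constructor
  · rintro ⟨v, hv, rfl⟩
    exact ⟨WithLp.toLp 2 v, by rwa [← vnorm_eq_norm_toLp], by rw [vnorm_eq_norm_toLp]; rfl⟩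
  · rintro ⟨v, hv, rfl⟩
    exact ⟨v.ofLp, by rwa [vnorm_eq_norm_toLp], by rw [vnorm_eq_norm_toLp]; rfl⟩

theorem vnorm_mulVec_le {m n : ℕ} (X : Matrix (Fin m) (Fin n) ℂ) (v : Fin n → ℂ) :
    vnorm (X *ᵥ v) ≤ ‖X‖ * vnorm v := by
  rw [vnorm_eq_norm_toLp, vnorm_eq_norm_toLp]
  exact l2_opNorm_mulVec X (WithLp.toLp 2 v)

theorem l2_opNorm_le_of_vnorm_mulVec_le {m n : ℕ} {X : Matrix (Fin m) (Fin n) ℂ} {C : ℝ}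
    (hC : 0 ≤ C) (h : ∀ v, vnorm (X *ᵥ v) ≤ C * vnorm v) : ‖X‖ ≤ C := by
  rw [l2_opNorm_def]
  refine ContinuousLinearMap.opNorm_le_bound _ hC fun v => ?_
  have hv := h v.ofLp
  rw [vnorm_eq_norm_toLp, vnorm_eq_norm_toLp] at hv
  exact hv

theorem norm_star_dotProduct_le {n : ℕ} (u v : Fin n → ℂ) :
    ‖star u ⬝ᵥ v‖ ≤ vnorm u * vnorm v := by
  rw [vnorm_eq_norm_toLp, vnorm_eq_norm_toLp, dotProduct_comm]
  exact norm_inner_le_norm (𝕜 := ℂ) (WithLp.toLp 2 u) (WithLp.toLp 2 v)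

theorem vnorm_sq_eq_norm_dotProduct {n : ℕ} (v : Fin n → ℂ) :
    vnorm v ^ 2 = ‖star v ⬝ᵥ v‖ := by
  have h : star v ⬝ᵥ v = ((vnorm v ^ 2 : ℝ) : ℂ) := by
    rw [vnorm_sq]
    push_cast
    exact Finset.sum_congr rfl fun j _ => Complex.conj_mul' _
  rw [h, Complex.norm_real, Real.norm_of_nonneg (sq_nonneg _)]

/-- A factorization of `Xᴴ * X` bounds `X` pointwise. -/
theorem vnorm_mulVec_sq_le {m n : ℕ} {X : Matrix (Fin m) (Fin n) ℂ} {η ξ : Fin n → ℂ}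
    {B : Matrix (Fin n) (Fin n) ℂ} (h : Xᴴ * X = diagonal η * B * diagonal ξ)
    (v : Fin n → ℂ) :
    vnorm (X *ᵥ v) ^ 2 ≤ ‖B‖ * (vnorm (star η * v) * vnorm (ξ * v)) := by
  have h₁ : star (X *ᵥ v) ⬝ᵥ (X *ᵥ v) = star (star η * v) ⬝ᵥ (B *ᵥ (ξ * v)) := by
    have hξ : diagonal ξ *ᵥ v = ξ * v := by
      ext j
      simp [mulVec_diagonal]
    have hη : star v ᵥ* diagonal η = star (star η * v) := by
      ext j
      simp [vecMul_diagonal, mul_comm]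
    rw [star_mulVec, ← dotProduct_mulVec, mulVec_mulVec, h, ← mulVec_mulVec, ← mulVec_mulVec,
      hξ, dotProduct_mulVec, hη]
  rw [vnorm_sq_eq_norm_dotProduct, h₁]
  calc _ ≤ vnorm (star η * v) * vnorm (B *ᵥ (ξ * v)) := norm_star_dotProduct_le _ _
    _ ≤ vnorm (star η * v) * (‖B‖ * vnorm (ξ * v)) :=
        mul_le_mul_of_nonneg_left (vnorm_mulVec_le _ _) (vnorm_nonneg _)
    _ = _ := by ring

theorem exists_eq_mul_diagonal {m n : ℕ} {X : Matrix (Fin m) (Fin n) ℂ} {ζ : Fin n → ℂ}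
    {C : ℝ} (hC : 0 ≤ C) (h : ∀ v, vnorm (X *ᵥ v) ≤ C * vnorm (ζ * v)) :
    ∃ A : Matrix (Fin m) (Fin n) ℂ, X = A * diagonal ζ ∧ ‖A‖ ≤ C := by
  refine ⟨X * diagonal ζ⁻¹, ?_, l2_opNorm_le_of_vnorm_mulVec_le hC fun v => ?_⟩
  · ext i j
    rw [mul_diagonal, mul_diagonal]
    by_cases hj : ζ j = 0
    · have hcol : X *ᵥ Pi.single j 1 = 0 := by
        have hz : ζ * Pi.single j 1 = 0 := by
          rw [← Pi.single_mul_right, hj, zero_mul, Pi.single_zero]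
        have := h (Pi.single j 1)
        rw [hz, vnorm_eq_zero.2 rfl, mul_zero] at this
        exact vnorm_eq_zero.1 (this.antisymm (vnorm_nonneg _))
      have := congrFun hcol i
      simp at this
      simp [hj, this]
    · simp [hj]
  · rw [← mulVec_mulVec]
    refine (h _).trans (mul_le_mul_of_nonneg_left ?_ hC)
    refine Real.sqrt_le_sqrt (Finset.sum_le_sum fun j _ => ?_)
    rw [Pi.mul_apply, mulVec_diagonal, Pi.inv_apply]
    by_cases hj : ζ j = 0
    · simp [hj]
    · rw [mul_inv_cancel_left₀ hj]

theorem cbF_nonneg {m n : ℕ} (X : Matrix (Fin m) (Fin n) ℂ) : 0 ≤ cbF X := by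
  refine Real.sInf_nonneg ?_
  rintro _ ⟨A, ξ, -, rfl⟩
  rw [opNorm_eq_norm]
  exact mul_nonneg (norm_nonneg _) (vnorm_nonneg _)

theorem cbF_le {m n : ℕ} {X A : Matrix (Fin m) (Fin n) ℂ} {ξ : Fin n → ℂ}
    (h : X = A * diagonal ξ) : cbF X ≤ ‖A‖ * vnorm ξ := by
  refine csInf_le ⟨0, ?_⟩ ⟨A, ξ, h, by rw [opNorm_eq_norm]⟩
  rintro _ ⟨A, ξ, -, rfl⟩
  rw [opNorm_eq_norm]
  exact mul_nonneg (norm_nonneg _) (vnorm_nonneg _)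

theorem cbB_le {m n : ℕ} {Y B : Matrix (Fin m) (Fin n) ℂ} {η : Fin m → ℂ} {ξ : Fin n → ℂ}
    (h : Y = diagonal η * B * diagonal ξ) : cbB Y ≤ vnorm η * ‖B‖ * vnorm ξ := by
  refine csInf_le ⟨0, ?_⟩ ⟨η, B, ξ, h, by rw [opNorm_eq_norm]⟩
  rintro _ ⟨η, B, ξ, -, rfl⟩
  rw [opNorm_eq_norm]
  exact mul_nonneg (mul_nonneg (vnorm_nonneg _) (norm_nonneg _)) (vnorm_nonneg _)

theorem cbB_conjTranspose_mul_self_le {m n : ℕ} (X : Matrix (Fin m) (Fin n) ℂ) :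
    cbB (Xᴴ * X) ≤ cbF X ^ 2 := by
  refine (Real.sqrt_le_left (cbF_nonneg X)).1 (le_csInf ⟨_, X, 1, by simp, rfl⟩ ?_)
  rintro _ ⟨A, ξ, rfl, rfl⟩
  rw [opNorm_eq_norm]
  refine Real.sqrt_le_iff.2 ⟨mul_nonneg (norm_nonneg _) (vnorm_nonneg _), ?_⟩
  have h : (A * diagonal ξ)ᴴ * (A * diagonal ξ) = diagonal (star ξ) * (Aᴴ * A) * diagonal ξ := by
    rw [conjTranspose_mul, diagonal_conjTranspose]
    simp only [Matrix.mul_assoc]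
  refine (cbB_le h).trans_eq ?_
  rw [vnorm_star, l2_opNorm_conjTranspose_mul_self]
  ring

theorem cbF_sq_le_of_factorization {m n : ℕ} {X : Matrix (Fin m) (Fin n) ℂ} {η ξ : Fin n → ℂ}
    {B : Matrix (Fin n) (Fin n) ℂ} (h : Xᴴ * X = diagonal η * B * diagonal ξ) :
    cbF X ^ 2 ≤ vnorm η * ‖B‖ * vnorm ξ := by
  by_cases h₀ : η = 0 ∨ ξ = 0
  · have hX : X = 0 := by
      rw [← conjTranspose_mul_self_eq_zero, h]
      rcases h₀ with rfl | rfl <;> simp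
    have hle : cbF X ≤ ‖(0 : Matrix (Fin m) (Fin n) ℂ)‖ * vnorm (0 : Fin n → ℂ) :=
      cbF_le (by simp [hX])
    have hz : cbF X = 0 := by
      rw [norm_zero, zero_mul] at hle
      exact hle.antisymm (cbF_nonneg X)
    rw [hz, zero_pow two_ne_zero]
    exact mul_nonneg (mul_nonneg (vnorm_nonneg _) (norm_nonneg _)) (vnorm_nonneg _)
  push Not at h₀
  have hη : 0 < vnorm η := (vnorm_nonneg η).lt_of_ne' fun h => h₀.1 (vnorm_eq_zero.1 h)
  have hξ : 0 < vnorm ξ := (vnorm_nonneg ξ).lt_of_ne' fun h => h₀.2 (vnorm_eq_zero.1 h)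
  set s := vnorm η with hs
  set t := vnorm ξ with ht
  -- The weights balance the two diagonal factors.
  let ζ : Fin n → ℂ := fun j =>
    (Real.sqrt ((t / s * ‖η j‖ ^ 2 + s / t * ‖ξ j‖ ^ 2) / 2) : ℝ)
  have hζ (j : Fin n) : ‖ζ j‖ ^ 2 = (t / s * ‖η j‖ ^ 2 + s / t * ‖ξ j‖ ^ 2) / 2 := by
    rw [Complex.norm_real, Real.norm_of_nonneg (Real.sqrt_nonneg _), Real.sq_sqrt (by positivity)]
  have hζv (v : Fin n → ℂ) : vnorm (ζ * v) ^ 2 =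
      (t / s * vnorm (star η * v) ^ 2 + s / t * vnorm (ξ * v) ^ 2) / 2 := by
    simp only [vnorm_sq, Finset.mul_sum, ← Finset.sum_add_distrib, Finset.sum_div]
    refine Finset.sum_congr rfl fun j _ => ?_
    simp only [Pi.mul_apply, norm_mul, mul_pow, hζ, Pi.star_apply, norm_star]
    ring
  have hζn : vnorm ζ ^ 2 = s * t := by
    have := hζv 1
    rw [mul_one, mul_one, mul_one, vnorm_star, ← hs, ← ht] at this
    rw [this]
    field_simp
    ring
  have hbound (v : Fin n → ℂ) : vnorm (X *ᵥ v) ≤ Real.sqrt ‖B‖ * vnorm (ζ * v) := by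
    refine abs_le_of_sq_le_sq' ?_ (mul_nonneg (Real.sqrt_nonneg _) (vnorm_nonneg _)) |>.2
    rw [mul_pow, Real.sq_sqrt (norm_nonneg _), hζv]
    refine (vnorm_mulVec_sq_le h v).trans (mul_le_mul_of_nonneg_left ?_ (norm_nonneg _))
    set a := vnorm (star η * v)
    set b := vnorm (ξ * v)
    have hsq : (t / s * a ^ 2 + s / t * b ^ 2) / 2 - a * b = (t * a - s * b) ^ 2 / (2 * s * t) := by
      field_simp
      ring
    have : 0 ≤ (t * a - s * b) ^ 2 / (2 * s * t) := by positivity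
    linarith
  obtain ⟨A, hA, hAn⟩ := exists_eq_mul_diagonal (Real.sqrt_nonneg _) hbound
  calc cbF X ^ 2 ≤ (Real.sqrt ‖B‖ * vnorm ζ) ^ 2 :=
        pow_le_pow_left₀ (cbF_nonneg X)
          ((cbF_le hA).trans (mul_le_mul_of_nonneg_right hAn (vnorm_nonneg _))) 2
    _ = s * ‖B‖ * t := by
        rw [mul_pow, Real.sq_sqrt (norm_nonneg _), hζn]
        ring

theorem stmt17 {m n : ℕ} (X : Matrix (Fin m) (Fin n) ℂ) :
    cbF X ^ 2 = cbB (Xᴴ * X) := by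
  refine le_antisymm (le_csInf ⟨_, 1, Xᴴ * X, 1, by simp, rfl⟩ ?_)
    (cbB_conjTranspose_mul_self_le X)
  rintro _ ⟨η, B, ξ, h, rfl⟩
  rw [opNorm_eq_norm]
  exact cbF_sq_le_of_factorization h

end MatFact
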